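/- Let α ∈ [1,2], let a ∈ L^∞(R²) with ‖a‖_{L^∞} ≤ 1, let N₁, N₂ ≥ 1 be dyadic numbers, let 0 < T < 1 and let φ₁, φ₂ ∈ L²(T). Then there exist K₀ ≥ 1 and C > 0 depending only on p_{α+1} such that, if N₁∨N₂ ≥ K₀(N₁∧N₂), then for every θ ∈ [0,1] and every interval I ⊂ R with |I| ≤ (N₁∨N₂)^{−1} T: ‖Λ_a(e^{−tL_{α+1}}P_{N₁}φ₁, e^{−tL_{α+1}}P_{N₂}φ₂)‖_{L²(I; L²(T))} ≤ C T^{θ/2} (N₁∧N₂)^{θ/2} (N₁∨N₂)^{−1/2} ‖P_{N₁}φ₁‖_{L²(T)} ‖P_{N₂}φ₂‖_{L²(T)}. -/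

import Mathlib

open MeasureTheory Complex Real Set Filter
open scoped ENNReal NNReal

noncomputable section

/-- **Hypothesis 1**: `p` is the symbol of the dispersive operator `L_{α+1}`
(the Fourier multiplier by `-i p(ξ)`); `p` is an odd real-valued function of class `C¹`
on `ℝ` and `C²` away from the origin, and for `ξ ≥ ξ₀` the first and second derivatives
of `p` are comparable to `ξ^α` and `ξ^(α-1)` respectively. -/
structure Hyp1 (α ξ₀ c C : ℝ) (p : ℝ → ℝ) : Prop where
  xi0_pos : 0 < ξ₀
  c_pos : 0 < c
  c_le_C : c ≤ C
  smooth1 : ContDiff ℝ 1 p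
  smooth2 : ∀ x : ℝ, x ≠ 0 → ContDiffAt ℝ 2 p x
  odd : ∀ x : ℝ, p (-x) = -p x
  deriv_lb : ∀ ξ : ℝ, ξ₀ ≤ ξ → c * ξ ^ α ≤ deriv p ξ
  deriv_ub : ∀ ξ : ℝ, ξ₀ ≤ ξ → deriv p ξ ≤ C * ξ ^ α
  deriv2_lb : ∀ ξ : ℝ, ξ₀ ≤ ξ → c * ξ ^ (α - 1) ≤ deriv (deriv p) ξ
  deriv2_ub : ∀ ξ : ℝ, ξ₀ ≤ ξ → deriv (deriv p) ξ ≤ C * ξ ^ (α - 1)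

/-- The fixed smooth even cutoff function `χ`: `0 ≤ χ ≤ 1`, `χ ≡ 1` on `[-1,1]`,
`supp χ ⊆ [-2,2]`. -/
structure CutoffFun (χ : ℝ → ℝ) : Prop where
  smooth : ContDiff ℝ (⊤ : ℕ∞) χ
  even : ∀ x : ℝ, χ (-x) = χ x
  nonneg : ∀ x : ℝ, 0 ≤ χ x
  le_one : ∀ x : ℝ, χ x ≤ 1
  eq_one : ∀ x ∈ Set.Icc (-1 : ℝ) 1, χ x = 1
  compact_supp : ∀ x : ℝ, χ x ≠ 0 → x ∈ Set.Icc (-2 : ℝ) 2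

/-- The Littlewood–Paley symbol `φ_N`: for a dyadic `N ≥ 1`, `φ_N(ξ) = χ(ξ/N) - χ(2ξ/N)`,
and `φ_0(ξ) = χ(2ξ)`. -/
def lpSymb (χ : ℝ → ℝ) (N ξ : ℝ) : ℝ :=
  if N = 0 then χ (2 * ξ) else χ (ξ / N) - χ (2 * ξ / N)

/-- The Littlewood–Paley projector `P_N`, acting on the (spatial) Fourier coefficients
of a function on the torus. -/
def PN (χ : ℝ → ℝ) (N : ℝ) (u : ℤ → ℂ) : ℤ → ℂ := fun ξ => (lpSymb χ N ξ : ℂ) * u ξ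

/-- Square of the `L²(𝕋)` norm, computed on Fourier coefficients (Parseval). -/
def l2sq (v : ℤ → ℂ) : ℝ := ∑' ξ : ℤ, ‖v ξ‖ ^ 2

/-- `L²(S × 𝕋)` norm of a space-time function given by its spatial Fourier
coefficients `U t ξ`, `S ⊆ ℝ` a set of times. -/
def L2normOn (S : Set ℝ) (U : ℝ → ℤ → ℂ) : ℝ := (∫ t in S, l2sq (U t)) ^ ((1:ℝ)/2)

/-- `L²(ℝ × 𝕋)` norm. -/
def L2full (U : ℝ → ℤ → ℂ) : ℝ := (∫ t : ℝ, l2sq (U t)) ^ ((1:ℝ)/2)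

/-- `L^∞(]0,T[; L²(𝕋))` norm. -/
def LinfL2 (T : ℝ) (U : ℝ → ℤ → ℂ) : ℝ := ⨆ t : Set.Ioo (0:ℝ) T, (l2sq (U t)) ^ ((1:ℝ)/2)

/-- Membership in `L²(ℝ × 𝕋)`. -/
def MemL2 (U : ℝ → ℤ → ℂ) : Prop :=
  (∀ t : ℝ, Summable fun ξ : ℤ => ‖U t ξ‖ ^ 2) ∧
  (∀ ξ : ℤ, Measurable fun t : ℝ => U t ξ) ∧
  Integrable (fun t : ℝ => l2sq (U t))

/-- Membership in `L^∞(]0,T[; L²(𝕋))`, together with measurability of the coefficients. -/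
def MemLinfL2 (T : ℝ) (U : ℝ → ℤ → ℂ) : Prop :=
  (∀ t ∈ Set.Ioo (0:ℝ) T, Summable fun ξ : ℤ => ‖U t ξ‖ ^ 2) ∧
  (∀ ξ : ℤ, Measurable fun t : ℝ => U t ξ) ∧
  (∃ M : ℝ, ∀ t ∈ Set.Ioo (0:ℝ) T, l2sq (U t) ≤ M)

/-- Continuity with values in `L²(𝕋)` on `[0,T]`. -/
def ContL2On (T : ℝ) (U : ℝ → ℤ → ℂ) : Prop :=
  ∀ t₀ ∈ Set.Icc (0:ℝ) T,
    Filter.Tendsto (fun t => l2sq (fun ξ => U t ξ - U t₀ ξ))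
      (nhdsWithin t₀ (Set.Icc (0:ℝ) T)) (nhds 0)

/-- Time Fourier transform (with the convention `∫ e^{-iτt} g(t) dt`). -/
def FT (g : ℝ → ℂ) (τ : ℝ) : ℂ := ∫ t : ℝ, Complex.exp (-(Complex.I * τ * t)) * g t

/-- Inverse time Fourier transform. -/
def IFT (g : ℝ → ℂ) (t : ℝ) : ℂ :=
  (2 * Real.pi)⁻¹ • ∫ τ : ℝ, Complex.exp (Complex.I * τ * t) * g τ

/-- The modulation projector `Q_L`, a space-time Fourier multiplier with symbol
`ψ_L(τ,ξ) = φ_L(τ - p(ξ))` (acting on spatial Fourier coefficients `U t ξ`). -/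
def QL (χ p : ℝ → ℝ) (L : ℝ) (U : ℝ → ℤ → ℂ) : ℝ → ℤ → ℂ := fun t ξ =>
  IFT (fun τ => (lpSymb χ L (τ - p ξ) : ℂ) * FT (fun s => U s ξ) τ) t

/-- `Q_{≤ 2^l} = Q_0 + ∑_{j ≤ l} Q_{2^j}`. -/
def Qle (χ p : ℝ → ℝ) (l : ℕ) (U : ℝ → ℤ → ℂ) : ℝ → ℤ → ℂ := fun t ξ =>
  QL χ p 0 U t ξ + ∑ j ∈ Finset.range (l + 1), QL χ p ((2:ℝ) ^ j) U t ξ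

/-- The `X^{0,1/2,1}` (Besov–Bourgain) norm:
`‖u‖ = ∑_L max(L,1)^{1/2} ‖Q_L u‖_{L²(ℝ×𝕋)}`, `L` running over `{0} ∪ 2^ℕ`. -/
def Xhalf (χ p : ℝ → ℝ) (U : ℝ → ℤ → ℂ) : ℝ :=
  L2full (QL χ p 0 U) + ∑' l : ℕ, ((2:ℝ) ^ l) ^ ((1:ℝ)/2) * L2full (QL χ p ((2:ℝ) ^ l) U)

/-- Membership in `X^{0,1/2,1}`. -/
def MemX (χ p : ℝ → ℝ) (U : ℝ → ℤ → ℂ) : Prop :=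
  (∀ ξ : ℤ, Measurable fun t : ℝ => U t ξ) ∧
  Integrable (fun t : ℝ => l2sq (QL χ p 0 U t)) ∧
  (∀ l : ℕ, Integrable fun t : ℝ => l2sq (QL χ p ((2:ℝ) ^ l) U t)) ∧
  Summable (fun l : ℕ => ((2:ℝ) ^ l) ^ ((1:ℝ)/2) * L2full (QL χ p ((2:ℝ) ^ l) U))

/-- The bilinear operator `Λ_a`:
`(Λ_a(u,v))^(ξ) = ∑_{ξ₁+ξ₂=ξ} a(ξ₁,ξ₂) û(ξ₁) v̂(ξ₂)`. -/
def Lam (a : ℝ → ℝ → ℂ) (u v : ℤ → ℂ) : ℤ → ℂ := fun ξ =>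
  ∑' ξ₁ : ℤ, a ξ₁ ((ξ : ℝ) - ξ₁) * u ξ₁ * v (ξ - ξ₁)

/-- `u` solves `∂_t u + L_{α+1} u + ∂_x f = 0` on `]0,T[ × 𝕋` (in the distributional
sense), formulated equivalently through the Duhamel formula on each spatial Fourier
mode; `U` and `F` are the spatial Fourier coefficients of `u` and `f`. -/
def Solves (p : ℝ → ℝ) (T : ℝ) (U F : ℝ → ℤ → ℂ) : Prop :=
  ∀ ξ : ℤ, ∀ t ∈ Set.Icc (0:ℝ) T,
    U t ξ = Complex.exp (Complex.I * (p ξ) * t) * U 0 ξ -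
      ∫ s in (0:ℝ)..t,
        Complex.exp (Complex.I * (p ξ) * (t - s)) * (Complex.I * (ξ:ℂ)) * F s ξ

/-- Fourier coefficients of the free evolution `e^{-tL_{α+1}} φ`. -/
def freeEvol (p : ℝ → ℝ) (φ : ℤ → ℂ) : ℝ → ℤ → ℂ := fun t ξ =>
  Complex.exp (Complex.I * (p ξ) * t) * φ ξ


lemma aux_gauss_int (M : ℝ) (hM : 0 < M) (w : ℝ) :
    Integrable (fun s : ℝ => cexp (I * (w:ℂ) * s) * cexp (-((M^2 : ℝ) : ℂ) * (s:ℂ)^2)) := by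
  have h := GaussianFourier.integrable_cexp_neg_mul_sq_add_real_mul_I (b := ((M^2 : ℝ) : ℂ))
    (by rw [Complex.ofReal_re]; positivity) 0
  have h0 := integrable_cexp_neg_mul_sq (b := ((M^2 : ℝ) : ℂ))
    (by rw [Complex.ofReal_re]; positivity)
  refine h0.bdd_mul (c := 1) (by fun_prop) ?_
  filter_upwards with s
  have : I * (w:ℂ) * s = ((w * s : ℝ) : ℂ) * I := by push_cast; ring
  rw [this, Complex.norm_exp_ofReal_mul_I]

lemma aux_gauss_val (M : ℝ) (hM : 0 < M) (w : ℝ) :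
    ‖∫ s : ℝ, cexp (I * (w:ℂ) * s) * cexp (-((M^2 : ℝ) : ℂ) * (s:ℂ)^2)‖
      ≤ √π / M * (1 + (w / M)^2 / 4)⁻¹ := by
  rw [fourierIntegral_gaussian (b := ((M^2 : ℝ) : ℂ)) (by rw [Complex.ofReal_re]; positivity)]
  rw [norm_mul]
  have h1 : ‖((π:ℂ) / ((M^2 : ℝ) : ℂ)) ^ (1 / 2 : ℂ)‖ = √π / M := by
    rw [← Complex.ofReal_div]
    rw [show (1/2 : ℂ) = ((1/2 : ℝ) : ℂ) by push_cast; rfl]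
    rw [← Complex.ofReal_cpow (by positivity), Complex.norm_real, ← Real.sqrt_eq_rpow,
      Real.sqrt_div (by positivity), Real.sqrt_sq hM.le]
    exact abs_of_nonneg (by positivity)
  have h2 : ‖cexp (-(w:ℂ)^2 / (4 * ((M^2 : ℝ) : ℂ)))‖ = Real.exp (-((w/M)^2/4)) := by
    have : -(w:ℂ)^2 / (4 * ((M^2 : ℝ) : ℂ)) = ((-((w/M)^2/4) : ℝ) : ℂ) := by
      have : (M:ℂ) ≠ 0 := by exact_mod_cast hM.ne'
      push_cast; field_simp
    rw [this, ← Complex.ofReal_exp, Complex.norm_real]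
    exact abs_of_nonneg (Real.exp_pos _).le
  rw [h1, h2, Real.exp_neg]
  gcongr
  have := Real.add_one_le_exp ((w/M)^2/4)
  linarith

def HH (δ : ℝ) : ℝ := ∑' n : ℤ, (1 + (δ * n)^2 / 4)⁻¹

lemma HH_summable (δ : ℝ) (hδ : 0 < δ) : Summable (fun n : ℤ => (1 + (δ * n)^2 / 4)⁻¹) := by
  have h : Summable (fun n : ℤ => (4/δ^2) * (1 / (n:ℝ)^2)) :=
    (Real.summable_one_div_int_pow.mpr (by norm_num)).mul_left _
  refine h.of_norm_bounded_eventually ?_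
  have : ∀ᶠ n : ℤ in cofinite, n ≠ 0 := by
    rw [Filter.eventually_cofinite]
    simp
  filter_upwards [this] with n hn
  have hn' : (n:ℝ) ≠ 0 := by exact_mod_cast hn
  have hp : 0 < (n:ℝ)^2 := by positivity
  rw [Real.norm_of_nonneg (by positivity)]
  rw [show 4/δ^2 * (1/(n:ℝ)^2) = ((δ * n)^2/4)⁻¹ by field_simp]
  gcongr
  linarith

lemma HH_sum_le (δ : ℝ) (hδ : 0 < δ) (S : Finset ℤ) (j : ℤ) :
    ∑ k ∈ S, (1 + (δ * ((j:ℝ) - k))^2 / 4)⁻¹ ≤ HH δ := by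
  have h := HH_summable δ hδ
  have e : HH δ = ∑' k : ℤ, (1 + (δ * ((j:ℝ) - k))^2 / 4)⁻¹ := by
    unfold HH
    rw [← (Equiv.subLeft j).tsum_eq]
    simp
  have h' : Summable (fun k : ℤ => (1 + (δ * ((j:ℝ) - k))^2 / 4)⁻¹) := by
    have := (Equiv.subLeft j).summable_iff.mpr h
    simpa [Function.comp_def] using this
  rw [e]
  exact h'.sum_le_tsum _ (fun i _ => by positivity)

lemma HH_nonneg (δ : ℝ) : 0 ≤ HH δ := tsum_nonneg (fun n => by positivity)

lemma expansion (S : Finset ℤ) (ω : ℤ → ℝ) (d : ℤ → ℂ) (M s : ℝ) :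
    ((Real.exp (-M^2 * s^2) * ‖∑ k ∈ S, cexp (I * (ω k) * s) * d k‖^2 : ℝ) : ℂ) =
      ∑ j ∈ S, ∑ k ∈ S, d j * (starRingEnd ℂ) (d k) *
        (cexp (I * ((ω j - ω k : ℝ):ℂ) * s) * cexp (-((M^2 : ℝ) : ℂ) * (s:ℂ)^2)) := by
  push_cast
  rw [← Complex.mul_conj', map_sum, Finset.sum_mul_sum, Finset.mul_sum]
  refine Finset.sum_congr rfl fun j _ => ?_
  rw [Finset.mul_sum]
  refine Finset.sum_congr rfl fun k _ => ?_
  rw [map_mul, ← Complex.exp_conj]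
  simp only [map_mul, Complex.conj_I, Complex.conj_ofReal]
  rw [show I * ((ω j : ℂ) - ω k) * s = I * ω j * s + (-I) * ω k * s by ring, Complex.exp_add]
  ring

lemma sieve_full (S : Finset ℤ) (ω : ℤ → ℝ) (d : ℤ → ℂ) (M δ : ℝ) (hM : 0 < M) (hδ : 0 < δ)
    (hsep : ∀ j ∈ S, ∀ k ∈ S, δ * M * |(j:ℝ) - k| ≤ |ω j - ω k|) :
    Integrable (fun s : ℝ => Real.exp (-M^2 * s^2) * ‖∑ k ∈ S, cexp (I * (ω k) * s) * d k‖^2) ∧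
    ∫ s : ℝ, Real.exp (-M^2 * s^2) * ‖∑ k ∈ S, cexp (I * (ω k) * s) * d k‖^2
      ≤ √π / M * HH δ * ∑ k ∈ S, ‖d k‖^2 := by
  have hint : ∀ j ∈ S, ∀ k ∈ S, Integrable (fun s : ℝ => d j * (starRingEnd ℂ) (d k) *
        (cexp (I * ((ω j - ω k : ℝ):ℂ) * s) * cexp (-((M^2 : ℝ) : ℂ) * (s:ℂ)^2))) :=
    fun j _ k _ => (aux_gauss_int M hM _).const_mul _
  have hI : Integrable (fun s : ℝ => ((Real.exp (-M^2 * s^2) *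
      ‖∑ k ∈ S, cexp (I * (ω k) * s) * d k‖^2 : ℝ) : ℂ)) := by
    simp_rw [expansion]
    exact integrable_finsetSum _ fun j hj => integrable_finsetSum _ fun k hk => hint j hj k hk
  refine ⟨by simpa only [RCLike.re_to_complex, Complex.ofReal_re] using hI.re, ?_⟩
  set X := ∫ s : ℝ, Real.exp (-M^2 * s^2) * ‖∑ k ∈ S, cexp (I * (ω k) * s) * d k‖^2 with hX
  have hXc : (X : ℂ) = ∑ j ∈ S, ∑ k ∈ S, d j * (starRingEnd ℂ) (d k) *
        ∫ s : ℝ, (cexp (I * ((ω j - ω k : ℝ):ℂ) * s) * cexp (-((M^2 : ℝ) : ℂ) * (s:ℂ)^2)) := by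
    rw [hX, ← integral_complex_ofReal]
    simp_rw [expansion]
    rw [integral_finsetSum _ fun j hj => integrable_finsetSum _ fun k hk => hint j hj k hk]
    refine Finset.sum_congr rfl fun j hj => ?_
    rw [integral_finsetSum _ fun k hk => hint j hj k hk]
    refine Finset.sum_congr rfl fun k hk => ?_
    rw [integral_const_mul]
  have h1 : X ≤ ‖(X:ℂ)‖ := by rw [Complex.norm_real]; exact le_abs_self _
  refine h1.trans ?_
  rw [hXc]
  have hterm : ∀ j ∈ S, ∀ k ∈ S, ‖d j * (starRingEnd ℂ) (d k) *
        ∫ s : ℝ, (cexp (I * ((ω j - ω k : ℝ):ℂ) * s) * cexp (-((M^2 : ℝ) : ℂ) * (s:ℂ)^2))‖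
      ≤ √π / M * (1/2 * (‖d j‖^2 * (1 + (δ * ((j:ℝ) - k))^2 / 4)⁻¹)
          + 1/2 * (‖d k‖^2 * (1 + (δ * ((k:ℝ) - j))^2 / 4)⁻¹)) := by
    intro j hj k hk
    rw [norm_mul, norm_mul, RCLike.norm_conj]
    have hg := aux_gauss_val M hM (ω j - ω k)
    have hw : (1 + ((ω j - ω k) / M)^2 / 4)⁻¹ ≤ (1 + (δ * ((j:ℝ) - k))^2 / 4)⁻¹ := by
      have := hsep j hj k hk
      have h3 : |δ * ((j:ℝ) - k)| ≤ |(ω j - ω k) / M| := by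
        rw [abs_div, abs_of_pos hM, le_div_iff₀ hM, abs_mul, abs_of_pos hδ]
        linarith
      have h4 := sq_le_sq.mpr h3
      gcongr
    have hsym : (δ * ((k:ℝ) - j))^2 = (δ * ((j:ℝ) - k))^2 := by ring
    rw [hsym]
    have hpm : 0 ≤ √π / M := by positivity
    set h := (1 + (δ * ((j:ℝ) - k))^2 / 4)⁻¹
    have hh : 0 ≤ h := by positivity
    calc _ ≤ ‖d j‖ * ‖d k‖ * (√π / M * h) := by
          refine mul_le_mul_of_nonneg_left (hg.trans ?_) (by positivity)
          exact mul_le_mul_of_nonneg_left hw hpm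
      _ = √π / M * h * (‖d j‖ * ‖d k‖) := by ring
      _ ≤ √π / M * h * (1/2 * (‖d j‖^2 + ‖d k‖^2)) := by
          refine mul_le_mul_of_nonneg_left ?_ (by positivity)
          nlinarith [sq_nonneg (‖d j‖ - ‖d k‖)]
      _ = _ := by ring
  have hS : ∑ j ∈ S, ∑ k ∈ S, ‖d j‖^2 * (1 + (δ * ((j:ℝ) - k))^2 / 4)⁻¹
      ≤ HH δ * ∑ k ∈ S, ‖d k‖^2 := by
    rw [Finset.mul_sum]
    refine Finset.sum_le_sum fun j hj => ?_
    rw [← Finset.mul_sum, mul_comm (HH δ)]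
    exact mul_le_mul_of_nonneg_left (HH_sum_le δ hδ S j) (by positivity)
  have hS' : ∑ j ∈ S, ∑ k ∈ S, ‖d k‖^2 * (1 + (δ * ((k:ℝ) - j))^2 / 4)⁻¹
      ≤ HH δ * ∑ k ∈ S, ‖d k‖^2 := by
    rw [Finset.sum_comm]; exact hS
  calc _ ≤ ∑ j ∈ S, ∑ k ∈ S, √π / M * (1/2 * (‖d j‖^2 * (1 + (δ * ((j:ℝ) - k))^2 / 4)⁻¹)
          + 1/2 * (‖d k‖^2 * (1 + (δ * ((k:ℝ) - j))^2 / 4)⁻¹)) :=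
        (norm_sum_le _ _).trans (Finset.sum_le_sum fun j hj =>
          (norm_sum_le _ _).trans (Finset.sum_le_sum fun k hk => hterm j hj k hk))
    _ = √π / M * (1/2 * (∑ j ∈ S, ∑ k ∈ S, ‖d j‖^2 * (1 + (δ * ((j:ℝ) - k))^2 / 4)⁻¹)
          + 1/2 * ∑ j ∈ S, ∑ k ∈ S, ‖d k‖^2 * (1 + (δ * ((k:ℝ) - j))^2 / 4)⁻¹) := by
        simp only [Finset.mul_sum, Finset.sum_add_distrib, mul_add]
    _ ≤ √π / M * (HH δ * ∑ k ∈ S, ‖d k‖^2) := by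
        refine mul_le_mul_of_nonneg_left ?_ (by positivity)
        linarith
    _ = _ := by ring

lemma sieve (S : Finset ℤ) (ω : ℤ → ℝ) (c : ℤ → ℂ) (M δ A B : ℝ) (hM : 0 < M) (hδ : 0 < δ)
    (hsep : ∀ j ∈ S, ∀ k ∈ S, δ * M * |(j:ℝ) - k| ≤ |ω j - ω k|) (hAB : B - A ≤ M⁻¹) :
    ∫ t in Ioo A B, ‖∑ k ∈ S, cexp (I * (ω k) * t) * c k‖^2
      ≤ Real.exp 1 * √π * HH δ / M * ∑ k ∈ S, ‖c k‖^2 := by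
  obtain ⟨hI, hb⟩ := sieve_full S ω (fun k => cexp (I * (ω k) * A) * c k) M δ hM hδ hsep
  have hn : ∀ k, ‖cexp (I * (ω k) * A) * c k‖ = ‖c k‖ := by
    intro k
    have : I * (ω k:ℂ) * A = ((ω k * A : ℝ) : ℂ) * I := by push_cast; ring
    rw [norm_mul, this, Complex.norm_exp_ofReal_mul_I, one_mul]
  simp only [hn] at hb
  set G : ℝ → ℝ := fun s => Real.exp (-M^2 * s^2) *
    ‖∑ k ∈ S, cexp (I * (ω k) * s) * (cexp (I * (ω k) * A) * c k)‖^2 with hG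
  have hI' : Integrable (fun t => Real.exp 1 * G (t - A)) := (hI.comp_sub_right A).const_mul _
  have hpt : ∀ t ∈ Ioo A B, ‖∑ k ∈ S, cexp (I * (ω k) * t) * c k‖^2
      ≤ Real.exp 1 * G (t - A) := by
    intro t ht
    have e : ∀ k, cexp (I * (ω k) * ((t - A : ℝ):ℂ)) * (cexp (I * (ω k) * A) * c k)
        = cexp (I * (ω k) * t) * c k := by
      intro k
      rw [← mul_assoc, ← Complex.exp_add]; congr 2; push_cast; ring
    simp only [hG, e]
    rw [← mul_assoc, ← Real.exp_add]
    refine le_mul_of_one_le_left (by positivity) ?_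
    apply Real.one_le_exp
    have h1 : M * (t - A) ≤ 1 := by
      have h2 : t - A ≤ M⁻¹ := by linarith [ht.2]
      calc M * (t - A) ≤ M * M⁻¹ := by gcongr
        _ = 1 := mul_inv_cancel₀ hM.ne'
    have h0 : 0 ≤ M * (t - A) := mul_nonneg hM.le (by linarith [ht.1])
    nlinarith
  calc _ ≤ ∫ t in Ioo A B, Real.exp 1 * G (t - A) := by
        refine setIntegral_mono_on ?_ hI'.integrableOn measurableSet_Ioo hpt
        refine (Continuous.integrableOn_Icc (a := A) (b := B) ?_).mono_set Ioo_subset_Icc_self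
        fun_prop
    _ ≤ ∫ t, Real.exp 1 * G (t - A) := by
        refine setIntegral_le_integral hI' ?_
        filter_upwards with t
        simp only [hG, Pi.zero_apply]; positivity
    _ = Real.exp 1 * ∫ t, G t := by
        rw [integral_const_mul, integral_sub_right_eq_self G A]
    _ ≤ Real.exp 1 * (√π / M * HH δ * ∑ k ∈ S, ‖c k‖^2) :=
        mul_le_mul_of_nonneg_left hb (Real.exp_pos _).le
    _ = _ := by ring

lemma gap (α ξ₀ c₀ C₀ : ℝ) (hα : α ∈ Set.Icc (1:ℝ) 2)
    (p : ℝ → ℝ) (hp : Hyp1 α ξ₀ c₀ C₀ p) :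
    ∃ K₀ : ℝ, 16 ≤ K₀ ∧ ∃ δ : ℝ, 0 < δ ∧ ∀ m M : ℝ, 1 ≤ m → K₀ * m ≤ M →
      ∀ ξ : ℝ, (∀ x ∈ Icc (-(2*m)) (2*m), M / 4 ≤ |ξ - x|) →
      ∀ x ∈ Icc (-(2*m)) (2*m), ∀ y ∈ Icc (-(2*m)) (2*m),
        δ * M * |x - y| ≤ |(p x + p (ξ - x)) - (p y + p (ξ - y))| := by
  have hc := hp.c_pos
  have hC : 0 < C₀ := hc.trans_le hp.c_le_C
  have hξ := hp.xi0_pos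
  have hdiff : Differentiable ℝ p := hp.smooth1.differentiable (by norm_num)
  have hcont : Continuous (deriv p) := hp.smooth1.continuous_deriv (by norm_num)
  have heven : ∀ x, deriv p (-x) = deriv p x := by
    intro x
    have h1 : deriv (fun x => p (-x)) x = - deriv p (-x) := deriv_comp_neg p x
    have h2 : (fun x => p (-x)) = fun x => - p x := funext hp.odd
    rw [h2, deriv.fun_neg] at h1
    linarith
  have habs : ∀ x, deriv p x = deriv p |x| := by
    intro x
    rcases abs_choice x with h | h <;> rw [h]
    rw [heven]
  obtain ⟨P, hP⟩ := (isCompact_Icc (a := (0:ℝ)) (b := ξ₀)).exists_bound_of_continuousOn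
    hcont.continuousOn
  have hP0 : 0 ≤ P := (norm_nonneg _).trans (hP 0 ⟨le_rfl, hξ.le⟩)
  set r : ℝ := 4 * C₀ / c₀ + 4 * P / c₀ + ξ₀ + 2 with hr
  have hr1 : 0 ≤ 4 * C₀ / c₀ := by positivity
  have hr2 : 0 ≤ 4 * P / c₀ := by positivity
  refine ⟨8 * r, by linarith, c₀ / 8, by positivity, ?_⟩
  intro m M hm hM ξ hfar x hx y hy
  have hy1 : 2 * m * r ≤ M / 4 := by nlinarith
  have hry : r ≤ M / 4 := by nlinarith
  have hM4 : 1 ≤ M / 4 := by linarith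
  -- low derivative bound
  have hYα : M / 4 ≤ (M/4) ^ α := by
    simpa using Real.rpow_le_rpow_of_exponent_le hM4 hα.1
  have hlow : ∀ z ∈ Icc (-(2*m)) (2*m), deriv p z ≤ c₀ / 2 * (M/4)^α := by
    intro z hz
    rw [habs]
    have hz' : |z| ≤ 2 * m := abs_le.mpr hz
    have e1 : P ≤ c₀ / 4 * (M/4)^α := by
      have : 4 * P / c₀ ≤ (M/4)^α := by linarith
      rw [div_le_iff₀ hc] at this
      linarith
    have e2 : C₀ * (2*m)^α ≤ c₀ / 4 * (M/4)^α := by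
      have h1 : (2 * m * r) ^ α ≤ (M/4)^α :=
        Real.rpow_le_rpow (by positivity) hy1 (by linarith [hα.1])
      rw [Real.mul_rpow (by positivity) (by linarith)] at h1
      have h2 : r ≤ r ^ α := by
        simpa using Real.rpow_le_rpow_of_exponent_le (by linarith : 1 ≤ r) hα.1
      have h3 : 4 * C₀ / c₀ ≤ r ^ α := by linarith
      have h4 : (2*m)^α * (4 * C₀ / c₀) ≤ (M/4)^α :=
        (mul_le_mul_of_nonneg_left h3 (by positivity)).trans h1
      have h5 : (2*m)^α * (4 * C₀ / c₀) = (4 * (C₀ * (2*m)^α)) / c₀ := by ring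
      rw [h5, div_le_iff₀ hc] at h4
      linarith
    rcases le_total |z| ξ₀ with h | h
    · have := (le_abs_self _).trans (hP |z| ⟨abs_nonneg _, h⟩)
      have h0 : 0 ≤ C₀ * (2*m)^α := by positivity
      linarith
    · have := hp.deriv_ub _ h
      have h6 : |z| ^ α ≤ (2*m)^α := Real.rpow_le_rpow (abs_nonneg _) hz' (by linarith [hα.1])
      have h7 : C₀ * |z|^α ≤ C₀ * (2*m)^α := by gcongr
      linarith
  have hhigh : ∀ z ∈ Icc (-(2*m)) (2*m), c₀ * (M/4)^α ≤ deriv p (ξ - z) := by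
    intro z hz
    rw [habs]
    have h1 := hfar z hz
    have h2 := hp.deriv_lb _ (by linarith : ξ₀ ≤ |ξ - z|)
    have h6 : (M/4) ^ α ≤ |ξ - z|^α := Real.rpow_le_rpow (by linarith) h1 (by linarith [hα.1])
    have h7 : c₀ * (M/4)^α ≤ c₀ * |ξ - z|^α := by gcongr
    linarith
  have hder : ∀ z, HasDerivAt (fun x => p x + p (ξ - x)) (deriv p z - deriv p (ξ - z)) z := by
    intro z
    have h1 := (hdiff z).hasDerivAt
    have h2 := ((hdiff (ξ - z)).hasDerivAt).comp_const_sub ξ z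
    have := h1.fun_add h2
    rw [sub_eq_add_neg]
    exact this
  have key : ∀ x ∈ Icc (-(2*m)) (2*m), ∀ y ∈ Icc (-(2*m)) (2*m), x ≤ y →
      (p y + p (ξ - y)) - (p x + p (ξ - x)) ≤ - (c₀ / 8 * M) * (y - x) := by
    intro x hx y hy hxy
    refine (convex_Icc (-(2*m)) (2*m)).image_sub_le_mul_sub_of_deriv_le
      (f := fun x => p x + p (ξ - x))
      (fun z _ => (hder z).continuousAt.continuousWithinAt)
      (fun z _ => (hder z).differentiableAt.differentiableWithinAt) ?_ x hx y hy hxy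
    intro z hz
    have hz' := interior_subset hz
    rw [(hder z).deriv]
    have := hlow z hz'
    have := hhigh z hz'
    have : c₀ / 2 * (M/4) ≤ c₀ / 2 * (M/4)^α := by gcongr
    linarith
  rcases le_total x y with h | h
  · have := key x hx y hy h
    rw [abs_sub_comm x y, abs_of_nonneg (by linarith : 0 ≤ y - x)]
    refine le_trans ?_ (le_abs_self _)
    linarith
  · have := key y hy x hx h
    rw [abs_of_nonneg (by linarith : 0 ≤ x - y), abs_sub_comm]
    refine le_trans ?_ (le_abs_self _)
    linarith

lemma norm_free (p : ℝ → ℝ) (k : ℤ) (t : ℝ) : ‖cexp (I * (p k) * t)‖ = 1 := by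
  have : I * (p k:ℂ) * t = ((p k * t : ℝ) : ℂ) * I := by push_cast; ring
  rw [this, Complex.norm_exp_ofReal_mul_I]

set_option maxHeartbeats 1000000 in
lemma core (p : ℝ → ℝ) (δ : ℝ) (hδ : 0 < δ) (m M : ℤ) (hm : 1 ≤ m) (hmM : 16 * m ≤ M)
    (hgap : ∀ ξ : ℝ, (∀ x ∈ Icc (-(2*(m:ℝ))) (2*m), (M:ℝ) / 4 ≤ |ξ - x|) →
      ∀ x ∈ Icc (-(2*(m:ℝ))) (2*m), ∀ y ∈ Icc (-(2*(m:ℝ))) (2*m),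
        δ * M * |x - y| ≤ |(p x + p (ξ - x)) - (p y + p (ξ - y))|)
    (a : ℝ → ℝ → ℂ) (ha : ∀ x y : ℝ, ‖a x y‖ ≤ 1) (f g : ℤ → ℂ)
    (hf : ∀ k, f k ≠ 0 → |(k:ℝ)| ≤ 2 * m)
    (hg : ∀ k, g k ≠ 0 → (M:ℝ) / 2 ≤ |(k:ℝ)| ∧ |(k:ℝ)| ≤ 2 * M)
    (T A B : ℝ) (hT : 0 < T) (hT1 : T < 1) (hAB : B - A ≤ (M:ℝ)⁻¹ * T) :
    (∫ t in Ioo A B, l2sq (Lam a (freeEvol p f t) (freeEvol p g t))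
      ≤ Real.exp 1 * √π * HH δ / M * (l2sq f * l2sq g)) ∧
    (∫ t in Ioo A B, l2sq (Lam a (freeEvol p f t) (freeEvol p g t))
      ≤ 5 * m * ((M:ℝ)⁻¹ * T) * (l2sq f * l2sq g)) := by
  have hmR : (1:ℝ) ≤ m := by exact_mod_cast hm
  have hmMR : 16 * (m:ℝ) ≤ M := by exact_mod_cast hmM
  have hM0 : (0:ℝ) < M := by linarith
  set S : Finset ℤ := Finset.Icc (-(2*m)) (2*m) with hS
  set R : Finset ℤ := Finset.Icc (-(4*M)) (4*M) with hR
  have hSmem : ∀ k ∈ S, (k:ℝ) ∈ Icc (-(2*(m:ℝ))) (2*m) := by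
    intro k hk
    rw [hS, Finset.mem_Icc] at hk
    exact ⟨by exact_mod_cast hk.1, by exact_mod_cast hk.2⟩
  have hfS : ∀ k, k ∉ S → f k = 0 := by
    intro k hk
    by_contra h
    have := abs_le.mp (hf k h)
    apply hk
    rw [hS, Finset.mem_Icc]
    exact ⟨by exact_mod_cast this.1, by exact_mod_cast this.2⟩
  have hgS : ∀ k, k ∉ R → g k = 0 := by
    intro k hk
    by_contra h
    have := abs_le.mp (hg k h).2
    apply hk
    rw [hR, Finset.mem_Icc]
    constructor
    · have : (-(4*M : ℝ)) ≤ k := by linarith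
      exact_mod_cast this
    · have : (k:ℝ) ≤ 4 * M := by linarith
      exact_mod_cast this
  have hgsum : Summable (fun k => ‖g k‖^2) :=
    summable_of_ne_finset_zero (s := R) (fun k hk => by simp [hgS k hk])
  have hfsum : l2sq f = ∑ k ∈ S, ‖f k‖^2 :=
    tsum_eq_sum (fun k hk => by simp [hfS k hk])
  set D : ℤ → ℤ → ℂ := fun ξ k => a k ((ξ:ℝ) - k) * f k * g (ξ - k) with hD
  set ω : ℤ → ℤ → ℝ := fun ξ k => p k + p ((ξ:ℝ) - k) with hω
  have hLam : ∀ t ξ, Lam a (freeEvol p f t) (freeEvol p g t) ξ =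
      ∑ k ∈ S, cexp (I * (ω ξ k) * t) * D ξ k := by
    intro t ξ
    unfold Lam freeEvol
    rw [tsum_eq_sum (s := S) (fun k hk => by simp [hfS k hk])]
    refine Finset.sum_congr rfl fun k _ => ?_
    simp only [hω, hD]
    push_cast
    rw [show I * ((p k:ℂ) + p ((ξ:ℝ) - k)) * t = I * p k * t + I * p ((ξ:ℝ) - k) * t by ring,
      Complex.exp_add]
    ring
  have hDR : ∀ ξ, ξ ∉ R → ∀ k ∈ S, D ξ k = 0 := by
    intro ξ hξ k hk
    simp only [hD]
    have : g (ξ - k) = 0 := by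
      by_contra h
      have h1 := abs_le.mp (hg _ h).2
      have h2 := hSmem k hk
      push_cast at h1
      apply hξ
      rw [hR, Finset.mem_Icc]
      constructor
      · have : (-(4*M : ℝ)) ≤ ξ := by linarith [h1.1, h2.1]
        exact_mod_cast this
      · have : (ξ:ℝ) ≤ 4 * M := by linarith [h1.2, h2.2]
        exact_mod_cast this
    rw [this, mul_zero]
  have hl2 : ∀ t, l2sq (Lam a (freeEvol p f t) (freeEvol p g t)) =
      ∑ ξ ∈ R, ‖∑ k ∈ S, cexp (I * (ω ξ k) * t) * D ξ k‖^2 := by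
    intro t
    unfold l2sq
    rw [tsum_eq_sum (s := R)]
    · simp only [hLam]
    · intro ξ hξ
      rw [hLam, Finset.sum_eq_zero (fun k hk => by rw [hDR ξ hξ k hk, mul_zero])]
      simp
  have hDsum : ∑ ξ ∈ R, ∑ k ∈ S, ‖D ξ k‖^2 ≤ l2sq f * l2sq g := by
    rw [Finset.sum_comm, hfsum, Finset.sum_mul]
    refine Finset.sum_le_sum fun k hk => ?_
    have h1 : ∀ ξ ∈ R, ‖D ξ k‖^2 ≤ ‖f k‖^2 * ‖g (ξ - k)‖^2 := by
      intro ξ _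
      simp only [hD, norm_mul, mul_pow]
      have : ‖a k ((ξ:ℝ) - k)‖^2 ≤ 1 := pow_le_one₀ (norm_nonneg _) (ha _ _)
      calc _ ≤ 1 * ‖f k‖^2 * ‖g (ξ - k)‖^2 := by gcongr
        _ = _ := by ring
    refine (Finset.sum_le_sum h1).trans ?_
    rw [← Finset.mul_sum]
    refine mul_le_mul_of_nonneg_left ?_ (by positivity)
    have h2 : Summable (fun ξ : ℤ => ‖g (ξ - k)‖^2) :=
      (Equiv.subRight k).summable_iff.mpr hgsum
    have h3 : l2sq g = ∑' ξ : ℤ, ‖g (ξ - k)‖^2 :=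
      ((Equiv.subRight k).tsum_eq (fun k => ‖g k‖^2)).symm
    rw [h3]
    exact h2.sum_le_tsum _ (fun i _ => by positivity)
  have hcont : ∀ ξ, Continuous (fun t : ℝ => ‖∑ k ∈ S, cexp (I * (ω ξ k) * t) * D ξ k‖^2) := by
    intro ξ; fun_prop
  have hintg : ∀ ξ, IntegrableOn
      (fun t : ℝ => ‖∑ k ∈ S, cexp (I * (ω ξ k) * t) * D ξ k‖^2) (Ioo A B) := fun ξ =>
    ((hcont ξ).integrableOn_Icc (a := A) (b := B)).mono_set Ioo_subset_Icc_self
  simp only [hl2]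
  rw [integral_finsetSum _ (fun ξ _ => hintg ξ)]
  have hHn := HH_nonneg δ
  constructor
  · refine le_trans ?_ (mul_le_mul_of_nonneg_left hDsum (by positivity))
    rw [Finset.mul_sum]
    refine Finset.sum_le_sum fun ξ _ => ?_
    by_cases h0 : ∀ k ∈ S, D ξ k = 0
    · have h1 : ∀ t : ℝ, ∑ k ∈ S, cexp (I * (ω ξ k) * t) * D ξ k = 0 := fun t =>
        Finset.sum_eq_zero (fun k hk => by rw [h0 k hk, mul_zero])
      simp only [h1]
      simp
      positivity
    · push Not at h0
      obtain ⟨k₀, hk₀, hne⟩ := h0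
      have hgne : g (ξ - k₀) ≠ 0 := by
        intro h; apply hne; simp only [hD]; rw [h, mul_zero]
      have hfar : ∀ x ∈ Icc (-(2*(m:ℝ))) (2*m), (M:ℝ) / 4 ≤ |(ξ:ℝ) - x| := by
        intro x hx
        have h1 := (hg _ hgne).1
        push_cast at h1
        have h2 := hSmem k₀ hk₀
        have h3 : |(ξ:ℝ) - k₀| ≤ |(ξ:ℝ) - x| + |x - k₀| := abs_sub_le _ _ _
        have h4 : |x - k₀| ≤ 4 * m := abs_le.mpr ⟨by linarith [hx.1, h2.2], by linarith [hx.2, h2.1]⟩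
        linarith
      refine sieve S (ω ξ) (D ξ) M δ A B hM0 hδ ?_ ?_
      · intro j hj k hk
        exact hgap ξ hfar j (hSmem j hj) k (hSmem k hk)
      · refine hAB.trans ?_
        have : 0 < (M:ℝ)⁻¹ := by positivity
        nlinarith
  · rcases le_or_gt B A with hBA | hBA
    · rw [Ioo_eq_empty (not_lt.mpr hBA)]
      simp
      have : 0 ≤ l2sq f := tsum_nonneg (fun _ => by positivity)
      have : 0 ≤ l2sq g := tsum_nonneg (fun _ => by positivity)
      positivity
    · refine le_trans ?_ (mul_le_mul_of_nonneg_left hDsum (by positivity))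
      rw [Finset.mul_sum]
      refine Finset.sum_le_sum fun ξ _ => ?_
      have hcard : (S.card : ℝ) ≤ 5 * m := by
        have : (S.card : ℤ) ≤ 5 * m := by
          rw [hS, Int.card_Icc]; omega
        exact_mod_cast this
      have hpt : ∀ t ∈ Ioo A B, ‖∑ k ∈ S, cexp (I * (ω ξ k) * t) * D ξ k‖^2
          ≤ 5 * m * ∑ k ∈ S, ‖D ξ k‖^2 := by
        intro t _
        have h1 : ‖∑ k ∈ S, cexp (I * (ω ξ k) * t) * D ξ k‖ ≤ ∑ k ∈ S, ‖D ξ k‖ := by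
          refine (norm_sum_le _ _).trans (Finset.sum_le_sum fun k _ => ?_)
          have : I * (ω ξ k:ℂ) * t = ((ω ξ k * t : ℝ) : ℂ) * I := by push_cast; ring
          rw [norm_mul, this, Complex.norm_exp_ofReal_mul_I, one_mul]
        calc _ ≤ (∑ k ∈ S, ‖D ξ k‖)^2 := by gcongr
          _ ≤ S.card * ∑ k ∈ S, ‖D ξ k‖^2 := sq_sum_le_card_mul_sum_sq
          _ ≤ _ := by gcongr
      calc _ ≤ ∫ t in Ioo A B, 5 * m * ∑ k ∈ S, ‖D ξ k‖^2 :=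
            setIntegral_mono_on (hintg ξ)
              (integrableOn_const (by rw [Real.volume_Ioo]; exact ENNReal.ofReal_ne_top))
              measurableSet_Ioo hpt
        _ = (B - A) * (5 * m * ∑ k ∈ S, ‖D ξ k‖^2) := by
            rw [setIntegral_const, smul_eq_mul, Real.volume_real_Ioo_of_le hBA.le]
        _ ≤ ((M:ℝ)⁻¹ * T) * (5 * m * ∑ k ∈ S, ‖D ξ k‖^2) := by gcongr
        _ = _ := by ring

lemma Lam_swap (a : ℝ → ℝ → ℂ) (u v : ℤ → ℂ) :
    Lam a u v = Lam (fun x y => a y x) v u := by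
  funext ξ
  unfold Lam
  rw [← (Equiv.subLeft ξ).tsum_eq]
  refine tsum_congr fun k => ?_
  simp only [Equiv.subLeft_apply, Int.cast_sub, sub_sub_cancel]
  ring

lemma PN_free (χ p : ℝ → ℝ) (N : ℝ) (φ : ℤ → ℂ) (t : ℝ) :
    PN χ N (freeEvol p φ t) = freeEvol p (PN χ N φ) t := by
  funext ξ
  unfold PN freeEvol
  ring

lemma PN_supp (χ : ℝ → ℝ) (hχ : CutoffFun χ) (n : ℕ) (φ : ℤ → ℂ) (k : ℤ)
    (h : PN χ ((2:ℝ)^n) φ k ≠ 0) : (2:ℝ)^n / 2 ≤ |(k:ℝ)| ∧ |(k:ℝ)| ≤ 2 * (2:ℝ)^n := by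
  have hN : (0:ℝ) < 2^n := by positivity
  set N := (2:ℝ)^n
  have hs : lpSymb χ N k ≠ 0 := by
    intro h0; apply h; simp [PN, h0]
  unfold lpSymb at hs
  rw [if_neg hN.ne'] at hs
  constructor
  · by_contra hlt
    push Not at hlt
    apply hs
    have h1 := abs_lt.mp hlt
    rw [hχ.eq_one, hχ.eq_one, sub_self]
    · constructor
      · rw [le_div_iff₀ hN]; linarith
      · rw [div_le_iff₀ hN]; linarith
    · constructor
      · rw [le_div_iff₀ hN]; linarith
      · rw [div_le_iff₀ hN]; linarith
  · by_contra hlt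
    push Not at hlt
    apply hs
    have z1 : χ (k / N) = 0 := by
      by_contra h0
      have := hχ.compact_supp _ h0
      rw [Set.mem_Icc, ← abs_le, abs_div, abs_of_pos hN, div_le_iff₀ hN] at this
      linarith
    have z2 : χ (2 * k / N) = 0 := by
      by_contra h0
      have := hχ.compact_supp _ h0
      rw [Set.mem_Icc, ← abs_le, abs_div, abs_of_pos hN, div_le_iff₀ hN, abs_mul, abs_two] at this
      linarith
    rw [z1, z2, sub_self]

lemma interp (X D m M T θ F G : ℝ) (hD : 0 ≤ D) (hm : 1 ≤ m) (hM : 0 < M) (hT : 0 < T)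
    (hθ : θ ∈ Icc (0:ℝ) 1) (hX : 0 ≤ X)
    (hF : 0 ≤ F) (hG : 0 ≤ G) (h1 : X ≤ D / M * (F * G)) (h2 : X ≤ D * m * (M⁻¹ * T) * (F * G)) :
    X ^ ((1:ℝ)/2) ≤ D ^ ((1:ℝ)/2) * T ^ (θ/2) * m ^ (θ/2) * M ^ (-(1:ℝ)/2) *
      F ^ ((1:ℝ)/2) * G ^ ((1:ℝ)/2) := by
  have hm0 : 0 < m := by linarith
  have h3 : X ≤ D * (T * m)^θ * M⁻¹ * F * G := by
    rcases le_total (T * m) 1 with h | h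
    · have : T * m ≤ (T*m)^θ := by
        simpa using Real.rpow_le_rpow_of_exponent_ge (by positivity) h hθ.2
      calc X ≤ _ := h2
        _ = D * (T * m) * M⁻¹ * F * G := by ring
        _ ≤ _ := by gcongr
    · have : 1 ≤ (T*m)^θ := Real.one_le_rpow h hθ.1
      calc X ≤ _ := h1
        _ = D * 1 * M⁻¹ * F * G := by ring
        _ ≤ _ := by gcongr
  refine (Real.rpow_le_rpow hX h3 (by norm_num)).trans_eq ?_
  rw [Real.mul_rpow (by positivity) hG, Real.mul_rpow (by positivity) hF,
    Real.mul_rpow (by positivity) (by positivity), Real.mul_rpow hD (by positivity),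
    ← Real.rpow_mul (by positivity), Real.mul_rpow hT.le hm0.le, ← Real.rpow_neg_one M,
    ← Real.rpow_mul hM.le]
  rw [show θ * (1/2) = θ/2 by ring, show (-1:ℝ) * (1/2) = -1/2 by ring]
  ring

/-- Corollary `cor_free`, estimate (cor2):
bilinear estimate for free solutions in the non-balanced case
`N₁∨N₂ ≥ K₀(N₁∧N₂)`: for every `θ ∈ [0,1]` and any interval `I = ]A,B[` with
`|I| ≤ (N₁∨N₂)^{-1}T`,
`‖Λ_a(e^{-tL}P_{N₁}φ₁, e^{-tL}P_{N₂}φ₂)‖_{L²(I;L²)}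
  ≤ C T^{θ/2}(N₁∧N₂)^{θ/2}(N₁∨N₂)^{-1/2}‖P_{N₁}φ₁‖_{L²}‖P_{N₂}φ₂‖_{L²}`. -/
theorem free_bilinear_II
    (α ξ₀ c₀ C₀ : ℝ) (hα : α ∈ Set.Icc (1:ℝ) 2)
    (p : ℝ → ℝ) (hp : Hyp1 α ξ₀ c₀ C₀ p)
    (χ : ℝ → ℝ) (hχ : CutoffFun χ) :
    ∃ K₀ : ℝ, 1 ≤ K₀ ∧ ∃ C : ℝ, 0 < C ∧
      ∀ (T : ℝ), 0 < T → T < 1 →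
      ∀ (n₁ n₂ : ℕ),
      ∀ (a : ℝ → ℝ → ℂ), (∀ x y : ℝ, ‖a x y‖ ≤ 1) →
      ∀ (φ₁ φ₂ : ℤ → ℂ),
        (Summable fun ξ : ℤ => ‖φ₁ ξ‖ ^ 2) → (Summable fun ξ : ℤ => ‖φ₂ ξ‖ ^ 2) →
        K₀ * min ((2:ℝ) ^ n₁) ((2:ℝ) ^ n₂) ≤ max ((2:ℝ) ^ n₁) ((2:ℝ) ^ n₂) →
      ∀ θ : ℝ, θ ∈ Set.Icc (0:ℝ) 1 →
      ∀ (A B : ℝ), B - A ≤ (max ((2:ℝ) ^ n₁) ((2:ℝ) ^ n₂))⁻¹ * T →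
        L2normOn (Set.Ioo A B)
            (fun t => Lam a (PN χ ((2:ℝ) ^ n₁) (freeEvol p φ₁ t))
              (PN χ ((2:ℝ) ^ n₂) (freeEvol p φ₂ t))) ≤
          C * T ^ (θ/2) * (min ((2:ℝ) ^ n₁) ((2:ℝ) ^ n₂)) ^ (θ/2) *
            (max ((2:ℝ) ^ n₁) ((2:ℝ) ^ n₂)) ^ (-(1:ℝ)/2) *
            (l2sq (PN χ ((2:ℝ) ^ n₁) φ₁)) ^ ((1:ℝ)/2) *
            (l2sq (PN χ ((2:ℝ) ^ n₂) φ₂)) ^ ((1:ℝ)/2) := by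
  obtain ⟨K₀, hK, δ, hδ, hgap⟩ := gap α ξ₀ c₀ C₀ hα p hp
  have hHn := HH_nonneg δ
  set D : ℝ := Real.exp 1 * √π * HH δ + 5 with hDdef
  have hD0 : 0 < D := by positivity
  refine ⟨K₀, by linarith, D ^ ((1:ℝ)/2), by positivity, ?_⟩
  -- the ordered case
  have main : ∀ (T : ℝ), 0 < T → T < 1 → ∀ (n₁ n₂ : ℕ),
      ∀ (a : ℝ → ℝ → ℂ), (∀ x y : ℝ, ‖a x y‖ ≤ 1) → ∀ (φ₁ φ₂ : ℤ → ℂ),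
        K₀ * (2:ℝ) ^ n₁ ≤ (2:ℝ) ^ n₂ → ∀ θ : ℝ, θ ∈ Set.Icc (0:ℝ) 1 →
      ∀ (A B : ℝ), B - A ≤ ((2:ℝ) ^ n₂)⁻¹ * T →
        L2normOn (Set.Ioo A B)
            (fun t => Lam a (PN χ ((2:ℝ) ^ n₁) (freeEvol p φ₁ t))
              (PN χ ((2:ℝ) ^ n₂) (freeEvol p φ₂ t))) ≤
          D ^ ((1:ℝ)/2) * T ^ (θ/2) * ((2:ℝ) ^ n₁) ^ (θ/2) *
            ((2:ℝ) ^ n₂) ^ (-(1:ℝ)/2) *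
            (l2sq (PN χ ((2:ℝ) ^ n₁) φ₁)) ^ ((1:ℝ)/2) *
            (l2sq (PN χ ((2:ℝ) ^ n₂) φ₂)) ^ ((1:ℝ)/2) := by
    intro T hT hT1 n₁ n₂ a ha φ₁ φ₂ hNN θ hθ A B hAB
    have hm1 : (1:ℝ) ≤ 2 ^ n₁ := one_le_pow₀ (by norm_num)
    have hM0 : (0:ℝ) < 2 ^ n₂ := by positivity
    have c1 : (((2:ℤ)^n₁ : ℤ) : ℝ) = 2^n₁ := by push_cast; rfl
    have c2 : (((2:ℤ)^n₂ : ℤ) : ℝ) = 2^n₂ := by push_cast; rfl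
    have h16 : 16 * (2:ℤ)^n₁ ≤ 2^n₂ := by
      have : 16 * (2:ℝ)^n₁ ≤ 2^n₂ := le_trans (by gcongr) hNN
      exact_mod_cast this
    have hcore := core p δ hδ ((2:ℤ)^n₁) ((2:ℤ)^n₂) (one_le_pow₀ (by norm_num)) h16
      (by rw [c1, c2]; exact hgap _ _ hm1 hNN) a ha (PN χ ((2:ℝ) ^ n₁) φ₁)
      (PN χ ((2:ℝ) ^ n₂) φ₂)
      (by rw [c1]; exact fun k hk => (PN_supp χ hχ n₁ φ₁ k hk).2)
      (by rw [c2]; exact fun k hk => PN_supp χ hχ n₂ φ₂ k hk) T A B hT hT1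
      (by rw [c2]; exact hAB)
    rw [c1, c2] at hcore
    unfold L2normOn
    simp only [PN_free]
    have hF : 0 ≤ l2sq (PN χ ((2:ℝ) ^ n₁) φ₁) := tsum_nonneg (fun _ => by positivity)
    have hG : 0 ≤ l2sq (PN χ ((2:ℝ) ^ n₂) φ₂) := tsum_nonneg (fun _ => by positivity)
    refine interp _ D _ _ T θ _ _ hD0.le hm1 hM0 hT hθ ?_ hF hG ?_ ?_
    · exact integral_nonneg fun t => tsum_nonneg (fun _ => by positivity)
    · refine hcore.1.trans ?_
      gcongr
      rw [hDdef]; linarith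
    · refine hcore.2.trans ?_
      gcongr
      have : 0 ≤ Real.exp 1 * √π * HH δ := by positivity
      rw [hDdef]; linarith
  intro T hT hT1 n₁ n₂ a ha φ₁ φ₂ _ _ hNN θ hθ A B hAB
  rcases le_total ((2:ℝ)^n₁) ((2:ℝ)^n₂) with h | h
  · rw [min_eq_left h, max_eq_right h] at *
    exact main T hT hT1 n₁ n₂ a ha φ₁ φ₂ hNN θ hθ A B hAB
  · rw [min_eq_right h, max_eq_left h] at *
    have := main T hT hT1 n₂ n₁ (fun x y => a y x) (fun x y => ha y x) φ₂ φ₁ hNN θ hθ A B hAB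
    simp only [← Lam_swap a] at this
    refine this.trans_eq ?_
    ring

end
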